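/- For any two BMSCs W₁ and W₂ with finite output alphabets: I(⟨W₁,W₂⟩⁻) ≤ min{I(W₁), I(W₂)} and max{I(W₁), I(W₂)} ≤ I(⟨W₁,W₂⟩⁺). -/

import Mathlib

open Finset

section Channels

variable {Y Y₁ Y₂ : Type*}

/-- A binary-input channel with finite output alphabet: nonnegative entries,
each row summing to one. -/
def IsChannel [Fintype Y] (W : ZMod 2 → Y → ℝ) : Prop :=
  (∀ x y, 0 ≤ W x y) ∧ ∀ x, ∑ y, W x y = 1

/-- A binary-input memoryless symmetric channel (BMSC): a channel admitting an
involution of the output alphabet exchanging the two conditional distributions. -/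
def IsBMSC [Fintype Y] (W : ZMod 2 → Y → ℝ) : Prop :=
  IsChannel W ∧ ∃ π : Y → Y, Function.Involutive π ∧ ∀ y, W 1 y = W 0 (π y)

/-- The Bhattacharyya parameter of a binary-input channel. -/
noncomputable def Zparam [Fintype Y] (W : ZMod 2 → Y → ℝ) : ℝ :=
  ∑ y, Real.sqrt (W 0 y * W 1 y)

/-- The symmetric capacity of a binary-input channel. -/
noncomputable def capacity [Fintype Y] (W : ZMod 2 → Y → ℝ) : ℝ :=
  ∑ x : ZMod 2, ∑ y, (1 / 2) * W x y *
    Real.logb 2 (W x y / ((1 / 2) * (W 0 y + W 1 y)))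

/-- The minus polar transform ⟨W₁,W₂⟩⁻. -/
noncomputable def polarMinus [Fintype Y₁] [Fintype Y₂] (W₁ : ZMod 2 → Y₁ → ℝ)
    (W₂ : ZMod 2 → Y₂ → ℝ) : ZMod 2 → Y₁ × Y₂ → ℝ :=
  fun u₁ y => (1 / 2) * ∑ u₂ : ZMod 2, W₁ (u₁ + u₂) y.1 * W₂ u₂ y.2

/-- The plus polar transform ⟨W₁,W₂⟩⁺, with output (y₁, y₂, u₁). -/
noncomputable def polarPlus [Fintype Y₁] [Fintype Y₂] (W₁ : ZMod 2 → Y₁ → ℝ)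
    (W₂ : ZMod 2 → Y₂ → ℝ) : ZMod 2 → Y₁ × Y₂ × ZMod 2 → ℝ :=
  fun u₂ y => (1 / 2) * W₁ (y.2.2 + u₂) y.1 * W₂ u₂ y.2.1

end Channels

section CapacityTerm

lemma sum_zmod_two (f : ZMod 2 → ℝ) : ∑ x, f x = f 0 + f 1 := Fin.sum_univ_two f

/-- The tangent-line bound behind the log-sum inequality. -/
lemma mul_logb_two_div_ge {a s A S : ℝ} (ha : 0 ≤ a) (hs : 0 ≤ s) (has : s = 0 → a = 0)
    (hA : 0 ≤ A) (hS : 0 < S) (haA : a ≤ A) :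
    a * Real.logb 2 (A / S) + (a - s * (A / S)) / Real.log 2 ≤ a * Real.logb 2 (a / s) := by
  have hlog : 0 < Real.log 2 := Real.log_pos one_lt_two
  rcases ha.eq_or_lt with rfl | ha
  · have : 0 ≤ s * (A / S) / Real.log 2 := by positivity
    simp only [zero_mul, zero_sub, zero_add, neg_div]
    linarith
  have hs : 0 < s := hs.lt_of_ne fun h => ha.ne' (has h.symm)
  have hA : 0 < A := ha.trans_le haA
  have key := Real.one_sub_inv_le_log_of_pos (x := (a / s) / (A / S)) (by positivity)
  rw [Real.log_div (by positivity) (by positivity)] at key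
  have hmul := mul_le_mul_of_nonneg_left key ha.le
  have hinv : a * (1 - ((a / s) / (A / S))⁻¹) = a - s * (A / S) := by field_simp
  rw [hinv] at hmul
  simp only [Real.logb, ← mul_div_assoc, ← add_div]
  gcongr
  simp only [mul_div_assoc] at hmul ⊢
  linarith

/-- The log-sum inequality. -/
lemma sum_mul_logb_two_div_le {ι : Type*} [Fintype ι] {a s : ι → ℝ} (ha : ∀ i, 0 ≤ a i)
    (hs : ∀ i, 0 ≤ s i) (has : ∀ i, s i = 0 → a i = 0) :
    (∑ i, a i) * Real.logb 2 ((∑ i, a i) / ∑ i, s i) ≤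
      ∑ i, a i * Real.logb 2 (a i / s i) := by
  rcases (sum_nonneg fun i (_ : i ∈ univ) => hs i).eq_or_lt with hS | hS
  · have hzero : ∀ i, a i = 0 := fun i =>
      has i ((sum_eq_zero_iff_of_nonneg fun j _ => hs j).1 hS.symm i (mem_univ i))
    simp [hzero]
  calc
    _ = ∑ i, (a i * Real.logb 2 ((∑ j, a j) / ∑ j, s j) +
          (a i - s i * ((∑ j, a j) / ∑ j, s j)) / Real.log 2) := by
      rw [sum_add_distrib, ← sum_mul, ← sum_div, sum_sub_distrib, ← sum_mul,
        mul_div_cancel₀ _ hS.ne', sub_self, zero_div, add_zero]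
    _ ≤ _ := sum_le_sum fun i _ => mul_logb_two_div_ge (ha i) (hs i) (has i)
      (sum_nonneg fun j _ => ha j) hS (single_le_sum (fun j _ => ha j) (mem_univ i))

/-- The contribution to the symmetric capacity of an output symbol whose two transition
probabilities are `a` and `b`. -/
noncomputable def capacityTerm (a b : ℝ) : ℝ :=
  1 / 2 * a * Real.logb 2 (a / (1 / 2 * (a + b))) +
    1 / 2 * b * Real.logb 2 (b / (1 / 2 * (a + b)))

lemma capacity_eq_sum_capacityTerm {Y : Type*} [Fintype Y] (W : ZMod 2 → Y → ℝ) :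
    capacity W = ∑ y, capacityTerm (W 0 y) (W 1 y) := by
  simp only [capacity, capacityTerm, sum_zmod_two, sum_add_distrib]

lemma capacityTerm_comm (a b : ℝ) : capacityTerm a b = capacityTerm b a := by
  simp only [capacityTerm, add_comm]

lemma capacityTerm_mul (k a b : ℝ) : capacityTerm (k * a) (k * b) = k * capacityTerm a b := by
  rcases eq_or_ne k 0 with rfl | hk
  · simp [capacityTerm]
  have h : ∀ x, k * x / (1 / 2 * (k * a + k * b)) = x / (1 / 2 * (a + b)) := fun x => by
    rw [← mul_add, mul_left_comm, mul_div_mul_left _ _ hk]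
  simp only [capacityTerm, h]
  ring

lemma capacityTerm_sum_le {ι : Type*} [Fintype ι] {a b : ι → ℝ} (ha : ∀ i, 0 ≤ a i)
    (hb : ∀ i, 0 ≤ b i) :
    capacityTerm (∑ i, a i) (∑ i, b i) ≤ ∑ i, capacityTerm (a i) (b i) := by
  have hs : ∀ i, 0 ≤ 1 / 2 * (a i + b i) := fun i => by linarith [ha i, hb i]
  have h₁ := sum_mul_logb_two_div_le ha hs fun i h => by linarith [ha i, hb i]
  have h₂ := sum_mul_logb_two_div_le hb hs fun i h => by linarith [ha i, hb i]
  simp only [← mul_sum, sum_add_distrib] at h₁ h₂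
  simp only [capacityTerm, sum_add_distrib, mul_assoc, ← mul_sum] at h₁ h₂ ⊢
  linarith

lemma capacityTerm_le_sum_mul {ι : Type*} [Fintype ι] {p q : ι → ℝ} (hp : ∀ i, 0 ≤ p i)
    (hq : ∀ i, 0 ≤ q i) (hp_sum : ∑ i, p i = 1) (hq_sum : ∑ i, q i = 1) {a b : ℝ}
    (ha : 0 ≤ a) (hb : 0 ≤ b) :
    capacityTerm a b ≤ ∑ i, capacityTerm (a * p i) (b * q i) := by
  have h := capacityTerm_sum_le (fun i => mul_nonneg ha (hp i)) fun i => mul_nonneg hb (hq i)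
  rwa [← mul_sum, ← mul_sum, hp_sum, hq_sum, mul_one, mul_one] at h

lemma capacityTerm_mix_le {a b c d : ℝ} (ha : 0 ≤ a) (hb : 0 ≤ b) (hc : 0 ≤ c) (hd : 0 ≤ d) :
    capacityTerm (1 / 2 * (a * c + b * d)) (1 / 2 * (b * c + a * d)) ≤
      1 / 2 * (c + d) * capacityTerm a b := by
  have h := capacityTerm_sum_le (a := ![c * a, d * b]) (b := ![c * b, d * a])
    (by simp [Fin.forall_fin_two, mul_nonneg, *]) (by simp [Fin.forall_fin_two, mul_nonneg, *])
  simp only [Fin.sum_univ_two, Matrix.cons_val_zero, Matrix.cons_val_one, capacityTerm_mul,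
    capacityTerm_comm b a] at h
  rw [capacityTerm_mul, mul_comm a c, mul_comm b d, mul_comm b c, mul_comm a d]
  linarith

end CapacityTerm

section PolarTransforms

variable {Y₁ Y₂ : Type*} [Fintype Y₁] [Fintype Y₂]
  {W₁ : ZMod 2 → Y₁ → ℝ} {W₂ : ZMod 2 → Y₂ → ℝ}

lemma capacity_polarMinus (W₁ : ZMod 2 → Y₁ → ℝ) (W₂ : ZMod 2 → Y₂ → ℝ) :
    capacity (polarMinus W₁ W₂) = ∑ y₁, ∑ y₂,
      capacityTerm (1 / 2 * (W₁ 0 y₁ * W₂ 0 y₂ + W₁ 1 y₁ * W₂ 1 y₂))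
        (1 / 2 * (W₁ 1 y₁ * W₂ 0 y₂ + W₁ 0 y₁ * W₂ 1 y₂)) := by
  have h : (1 + 1 : ZMod 2) = 0 := rfl
  simp only [capacity_eq_sum_capacityTerm, polarMinus, sum_zmod_two, Fintype.sum_prod_type,
    add_zero, zero_add, h]

lemma capacity_polarPlus (W₁ : ZMod 2 → Y₁ → ℝ) (W₂ : ZMod 2 → Y₂ → ℝ) :
    capacity (polarPlus W₁ W₂) = ∑ y₁, ∑ y₂,
      1 / 2 * (capacityTerm (W₁ 0 y₁ * W₂ 0 y₂) (W₁ 1 y₁ * W₂ 1 y₂) +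
        capacityTerm (W₁ 1 y₁ * W₂ 0 y₂) (W₁ 0 y₁ * W₂ 1 y₂)) := by
  have h : (1 + 1 : ZMod 2) = 0 := rfl
  simp only [capacity_eq_sum_capacityTerm, polarPlus, sum_zmod_two, Fintype.sum_prod_type,
    add_zero, zero_add, h, mul_assoc, capacityTerm_mul, mul_add]

lemma capacity_polarMinus_le_left (h₁ : IsChannel W₁) (h₂ : IsChannel W₂) :
    capacity (polarMinus W₁ W₂) ≤ capacity W₁ := by
  rw [capacity_polarMinus, capacity_eq_sum_capacityTerm]
  refine sum_le_sum fun y₁ _ => ?_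
  refine (sum_le_sum fun y₂ _ =>
    capacityTerm_mix_le (h₁.1 0 y₁) (h₁.1 1 y₁) (h₂.1 0 y₂) (h₂.1 1 y₂)).trans_eq ?_
  rw [← sum_mul, ← mul_sum, sum_add_distrib, h₂.2, h₂.2]
  ring

lemma capacity_polarMinus_comm (W₁ : ZMod 2 → Y₁ → ℝ) (W₂ : ZMod 2 → Y₂ → ℝ) :
    capacity (polarMinus W₁ W₂) = capacity (polarMinus W₂ W₁) := by
  rw [capacity_polarMinus, capacity_polarMinus, sum_comm]
  refine sum_congr rfl fun y₂ _ => sum_congr rfl fun y₁ _ => ?_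
  congr 1 <;> ring

lemma capacity_polarPlus_comm (W₁ : ZMod 2 → Y₁ → ℝ) (W₂ : ZMod 2 → Y₂ → ℝ) :
    capacity (polarPlus W₁ W₂) = capacity (polarPlus W₂ W₁) := by
  rw [capacity_polarPlus, capacity_polarPlus, sum_comm]
  refine sum_congr rfl fun y₂ _ => sum_congr rfl fun y₁ _ => ?_
  rw [capacityTerm_comm (W₁ 1 y₁ * W₂ 0 y₂)]
  simp only [mul_comm]

lemma capacity_left_le_polarPlus (h₁ : IsChannel W₁) (h₂ : IsChannel W₂) :
    capacity W₁ ≤ capacity (polarPlus W₁ W₂) := by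
  rw [capacity_polarPlus, capacity_eq_sum_capacityTerm]
  refine sum_le_sum fun y₁ _ => ?_
  rw [← mul_sum, sum_add_distrib]
  have h := capacityTerm_le_sum_mul (h₂.1 0) (h₂.1 1) (h₂.2 0) (h₂.2 1) (h₁.1 0 y₁) (h₁.1 1 y₁)
  have h' := capacityTerm_le_sum_mul (h₂.1 0) (h₂.1 1) (h₂.2 0) (h₂.2 1) (h₁.1 1 y₁) (h₁.1 0 y₁)
  rw [capacityTerm_comm] at h'
  linarith

end PolarTransforms

/-- for BMSCs, I(⟨W₁,W₂⟩⁻) ≤ min{I(W₁), I(W₂)} and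
max{I(W₁), I(W₂)} ≤ I(⟨W₁,W₂⟩⁺). -/
theorem capacity_polar_min_max {Y₁ Y₂ : Type*} [Fintype Y₁] [Fintype Y₂]
    (W₁ : ZMod 2 → Y₁ → ℝ) (W₂ : ZMod 2 → Y₂ → ℝ)
    (hW₁ : IsBMSC W₁) (hW₂ : IsBMSC W₂) :
    capacity (polarMinus W₁ W₂) ≤ min (capacity W₁) (capacity W₂) ∧
    max (capacity W₁) (capacity W₂) ≤ capacity (polarPlus W₁ W₂) := by
  have h₁ := hW₁.1
  have h₂ := hW₂.1
  refine ⟨le_min (capacity_polarMinus_le_left h₁ h₂) ?_,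
    max_le (capacity_left_le_polarPlus h₁ h₂) ?_⟩
  · rw [capacity_polarMinus_comm]
    exact capacity_polarMinus_le_left h₂ h₁
  · rw [capacity_polarPlus_comm]
    exact capacity_left_le_polarPlus h₂ h₁
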